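/- Let D be a finite set of nonzero vectors in ℝⁿ whose conic hull equals all of ℝⁿ (i.e., D is a positive spanning set). Then the cosine measure of D is positive: there exists μ > 0 such that for every nonzero v ∈ ℝⁿ there is d ∈ D with ⟨v, d⟩ ≥ μ‖v‖‖d‖. -/

import Mathlib

open scoped RealInnerProductSpace

/-- A nonzero vector in the conic hull of `D` has positive inner product with some element
of `D`. -/
theorem exists_mem_inner_pos_of_eq_sum {E : Type*} [NormedAddCommGroup E]
    [InnerProductSpace ℝ E] {D : Finset E} {v : E} (hv : v ≠ 0) {t : E → ℝ}
    (ht : ∀ d, 0 ≤ t d) (hvt : v = ∑ d ∈ D, t d • d) : ∃ d ∈ D, 0 < ⟪v, d⟫ := by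
  by_contra! h
  have hsum : ⟪v, v⟫ = ∑ d ∈ D, t d * ⟪v, d⟫ := by
    conv_lhs => rhs; rw [hvt]
    simp only [inner_sum, real_inner_smul_right]
  have hpos : 0 < ⟪v, v⟫ := real_inner_self_pos.mpr hv
  have hle : ∑ d ∈ D, t d * ⟪v, d⟫ ≤ 0 :=
    Finset.sum_nonpos fun d hd => mul_nonpos_of_nonneg_of_nonpos (ht d) (h d hd)
  linarith

theorem positive_spanning_implies_positive_cosine_measure {n : ℕ}
    (D : Finset (EuclideanSpace ℝ (Fin n))) (hD0 : ∀ d ∈ D, d ≠ 0)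
    (hspan : ∀ x : EuclideanSpace ℝ (Fin n), ∃ t : EuclideanSpace ℝ (Fin n) → ℝ,
      (∀ d, 0 ≤ t d) ∧ x = ∑ d ∈ D, t d • d) :
    ∃ μ : ℝ, 0 < μ ∧ ∀ v : EuclideanSpace ℝ (Fin n), v ≠ 0 →
      ∃ d ∈ D, μ * (‖v‖ * ‖d‖) ≤ ⟪v, d⟫ := by
  have key : ∀ v : EuclideanSpace ℝ (Fin n), v ≠ 0 → ∃ d ∈ D, 0 < ⟪v, d⟫ := fun v hv => by
    obtain ⟨t, ht, hvt⟩ := hspan v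
    exact exists_mem_inner_pos_of_eq_sum hv ht hvt
  by_cases hE : ∃ w : EuclideanSpace ℝ (Fin n), w ≠ 0
  swap
  · push Not at hE
    exact ⟨1, one_pos, fun v hv => absurd (hE v) hv⟩
  obtain ⟨w, hw⟩ := hE
  have hD : D.Nonempty := (key w hw).imp fun d hd => hd.1
  have hcont : Continuous fun v : EuclideanSpace ℝ (Fin n) =>
      D.sup' hD fun d => ⟪v, d⟫ / ‖d‖ :=
    Continuous.finset_sup'_apply hD fun d _ => by fun_prop
  have hunit : ∀ v : EuclideanSpace ℝ (Fin n), v ≠ 0 →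
      ‖v‖⁻¹ • v ∈ Metric.sphere (0 : EuclideanSpace ℝ (Fin n)) 1 := fun v hv => by
    simp [norm_smul, hv]
  obtain ⟨u, hu, hmin⟩ := (isCompact_sphere (0 : EuclideanSpace ℝ (Fin n)) 1).exists_isMinOn
    ⟨_, hunit w hw⟩ hcont.continuousOn
  refine ⟨D.sup' hD fun d => ⟪u, d⟫ / ‖d‖, ?_, fun v hv => ?_⟩
  · obtain ⟨d, hd, hpos⟩ := key u (ne_zero_of_mem_unit_sphere ⟨u, hu⟩)
    exact (Finset.lt_sup'_iff hD).mpr ⟨d, hd, div_pos hpos (norm_pos_iff.mpr (hD0 d hd))⟩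
  · obtain ⟨d, hd, hle⟩ :=
      (Finset.le_sup'_iff hD).mp (isMinOn_iff.mp hmin _ (hunit v hv))
    refine ⟨d, hd, ?_⟩
    have hv' : 0 < ‖v‖ := norm_pos_iff.mpr hv
    rw [le_div_iff₀ (norm_pos_iff.mpr (hD0 d hd)), real_inner_smul_left,
      le_inv_mul_iff₀ hv'] at hle
    linarith
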